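/- Let h : ℝ³ → ℝ be a harmonic homogeneous polynomial of degree n ≥ 1 and g : ℝ³ → ℝ a harmonic homogeneous polynomial of degree k ≥ 0. Then ∫_{S²} (∇h(x) × x) · ∇g(x) dσ(x) = 0, where S² is the unit sphere in ℝ³ and σ is the 2-dimensional surface (Hausdorff) measure on S². (This expresses the orthogonality in L²(S²)³ of the tangential fields 𝐓 = ∇_S Y × ν with the fields 𝐌 = ∇_S Y + n Y ν.) -/

import Mathlib

open MeasureTheory Real
open scoped RealInnerProductSpace

noncomputable section

/-- Three-dimensional Euclidean space. -/
abbrev E3 : Type := EuclideanSpace ℝ (Fin 3)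

/-- Build an element of `E3` from coordinates. -/
def toE3 (v : Fin 3 → ℝ) : E3 := (WithLp.equiv 2 (Fin 3 → ℝ)).symm v

/-- Partial derivative in the `i`-th coordinate direction. -/
def pd (f : E3 → ℝ) (i : Fin 3) (x : E3) : ℝ :=
  fderiv ℝ f x (EuclideanSpace.single i 1)

/-- The gradient, as the vector of partial derivatives. -/
def grad3 (f : E3 → ℝ) (x : E3) : E3 := toE3 fun i => pd f i x

/-- The Laplacian: the sum of the second partial derivatives. -/
def lap3 (f : E3 → ℝ) (x : E3) : ℝ := ∑ i, pd (pd f i) i x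

/-- Divergence of a vector field. -/
def div3 (u : E3 → E3) (x : E3) : ℝ := ∑ i, pd (fun y => u y i) i x

/-- Componentwise Laplacian of a vector field. -/
def vlap3 (u : E3 → E3) (x : E3) : E3 := toE3 fun i => lap3 (fun y => u y i) x

/-- Cross product in `ℝ³`. -/
def cross3 (u v : E3) : E3 :=
  toE3 ![u 1 * v 2 - u 2 * v 1, u 2 * v 0 - u 0 * v 2, u 0 * v 1 - u 1 * v 0]

/-- The function `ℝ³ → ℝ` determined by a polynomial in three variables. -/
def polyFun (P : MvPolynomial (Fin 3) ℝ) : E3 → ℝ :=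
  fun x => MvPolynomial.eval (fun i => x i) P

theorem MvPolynomial.pderiv_pderiv_comm {R σ : Type*} [CommRing R] (i j : σ)
    (P : MvPolynomial σ R) :
    MvPolynomial.pderiv i (MvPolynomial.pderiv j P) =
      MvPolynomial.pderiv j (MvPolynomial.pderiv i P) := by
  classical
  have h0 : ⁅(MvPolynomial.pderiv i : Derivation R (MvPolynomial σ R) (MvPolynomial σ R)),
      (MvPolynomial.pderiv j : Derivation R (MvPolynomial σ R) (MvPolynomial σ R))⁆ = 0 := by
    refine MvPolynomial.derivation_ext fun l => ?_
    rw [Derivation.commutator_apply, MvPolynomial.pderiv_X, MvPolynomial.pderiv_X]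
    by_cases hi : i = l <;> by_cases hj : j = l <;> simp [hi, hj]
  have h1 := congrArg (fun D : Derivation R (MvPolynomial σ R) (MvPolynomial σ R) => D P) h0
  simpa [Derivation.commutator_apply, sub_eq_zero] using h1

theorem hasFDerivAt_polyFun (P : MvPolynomial (Fin 3) ℝ) (x : E3) :
    HasFDerivAt (polyFun P)
      (∑ i, polyFun (MvPolynomial.pderiv i P) x • (EuclideanSpace.proj i : E3 →L[ℝ] ℝ)) x := by
  induction P using MvPolynomial.induction_on with
  | C a =>
    have e : polyFun (MvPolynomial.C a) = fun _ => a := by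
      ext y; simp [polyFun]
    rw [e]
    simpa [polyFun] using hasFDerivAt_const a x
  | add p q hp hq =>
    have h := hp.add hq
    rw [← Finset.sum_add_distrib] at h
    have e : polyFun (p + q) = polyFun p + polyFun q := by
      ext y; simp [polyFun]
    rw [e]
    simpa [polyFun, add_smul] using h
  | mul_X p j hp =>
    have h := hp.mul (EuclideanSpace.proj j : E3 →L[ℝ] ℝ).hasFDerivAt
    have e : polyFun (p * MvPolynomial.X j) =
        polyFun p * (fun y => (EuclideanSpace.proj j : E3 →L[ℝ] ℝ) y) := by
      ext y; simp [polyFun]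
    rw [e]
    refine h.congr_fderiv ?_
    ext v
    fin_cases j <;>
    · simp [polyFun, Fin.sum_univ_three, MvPolynomial.pderiv_X, Pi.single_apply]
      ring

theorem pd_polyFun (P : MvPolynomial (Fin 3) ℝ) (i : Fin 3) (x : E3) :
    pd (polyFun P) i x = polyFun (MvPolynomial.pderiv i P) x := by
  rw [pd, (hasFDerivAt_polyFun P x).fderiv]
  simp

theorem continuous_polyFun (P : MvPolynomial (Fin 3) ℝ) : Continuous (polyFun P) :=
  continuous_iff_continuousAt.2 fun x => (hasFDerivAt_polyFun P x).continuousAt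

/-- The spherical coordinate parametrization of the unit sphere. -/
def sphericalParam (p : Fin 2 → ℝ) : E3 :=
  !₂[sin (p 0) * cos (p 1), sin (p 0) * sin (p 1), cos (p 0)]

theorem contDiff_sphericalParam : ContDiff ℝ 1 sphericalParam := by
  rw [contDiff_euclidean]
  intro i
  fin_cases i <;> simp [sphericalParam] <;> fun_prop

theorem sphere_subset_image_sphericalParam :
    Metric.sphere (0 : E3) 1 ⊆ sphericalParam '' Set.Icc (fun _ => -π) (fun _ => π) := by
  intro x hx
  have hx1 : x 0 ^ 2 + x 1 ^ 2 + x 2 ^ 2 = 1 := by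
    have h : ‖x‖ ^ 2 = 1 := by simp [mem_sphere_zero_iff_norm.1 hx]
    simpa [EuclideanSpace.norm_sq_eq, Fin.sum_univ_three] using h
  have hz : -1 ≤ x 2 ∧ x 2 ≤ 1 := by constructor <;> nlinarith [sq_nonneg (x 0), sq_nonneg (x 1)]
  set w : ℂ := ⟨x 0, x 1⟩ with hw
  have hs : sin (arccos (x 2)) = ‖w‖ := by
    rw [Real.sin_arccos, Complex.norm_def, Complex.normSq_mk]
    congr 1
    linarith
  refine ⟨![arccos (x 2), Complex.arg w], ⟨?_, ?_⟩, ?_⟩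
  · intro i
    fin_cases i
    · simpa using (neg_nonpos.2 pi_pos.le).trans (arccos_nonneg (x 2))
    · simpa using (Complex.neg_pi_lt_arg w).le
  · intro i
    fin_cases i
    · simpa using arccos_le_pi (x 2)
    · simpa using Complex.arg_le_pi w
  · ext i
    fin_cases i
    · simp [sphericalParam, hs, Complex.norm_mul_cos_arg, hw]
    · simp [sphericalParam, hs, Complex.norm_mul_sin_arg, hw]
    · simp [sphericalParam, Real.cos_arccos hz.1 hz.2]

theorem hausdorffMeasure_sphere_lt_top : μH[2] (Metric.sphere (0 : E3) 1) < ⊤ := by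
  have hK : IsCompact (Set.Icc (fun _ => -π) (fun _ => π) : Set (Fin 2 → ℝ)) := isCompact_Icc
  obtain ⟨K, hL⟩ :=
    (contDiff_sphericalParam.locallyLipschitz.locallyLipschitzOn).exists_lipschitzOnWith_of_compact
      hK
  refine (measure_mono sphere_subset_image_sphericalParam).trans_lt ?_
  refine (hL.hausdorffMeasure_image_le (d := 2) (by norm_num)).trans_lt ?_
  have hv : (μH[2] : Measure (Fin 2 → ℝ)) = volume := by
    simpa using hausdorffMeasure_pi_real (ι := Fin 2)
  rw [hv]
  exact ENNReal.mul_lt_top (ENNReal.rpow_lt_top_of_nonneg (by norm_num) ENNReal.coe_ne_top)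
    hK.measure_lt_top

instance isFiniteMeasure_restrict_sphere :
    IsFiniteMeasure ((μH[2] : Measure E3).restrict (Metric.sphere 0 1)) :=
  ⟨by simpa using hausdorffMeasure_sphere_lt_top⟩

/-- The rotation by angle `t` in the coordinate plane spanned by the `i`-th and `j`-th axes. -/
def rot (i j : Fin 3) (t : ℝ) (x : E3) : E3 :=
  x + ((cos t - 1) • (EuclideanSpace.single i (x i) + EuclideanSpace.single j (x j)) +
    sin t • (EuclideanSpace.single j (x i) - EuclideanSpace.single i (x j)))

theorem rot_rot_neg {i j : Fin 3} (hij : i ≠ j) (t : ℝ) (x : E3) :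
    rot i j t (rot i j (-t) x) = x := by
  have h := sin_sq_add_cos_sq t
  ext l
  fin_cases i <;> fin_cases j <;> simp at hij <;> fin_cases l <;> simp [rot] <;> grind

theorem norm_rot {i j : Fin 3} (hij : i ≠ j) (t : ℝ) (x : E3) : ‖rot i j t x‖ = ‖x‖ := by
  have h := sin_sq_add_cos_sq t
  rw [EuclideanSpace.norm_eq, EuclideanSpace.norm_eq]
  congr 1
  fin_cases i <;> fin_cases j <;> simp at hij <;> simp [rot, Fin.sum_univ_three] <;> grind

theorem isometry_rot {i j : Fin 3} (hij : i ≠ j) (t : ℝ) : Isometry (rot i j t) := by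
  refine Isometry.of_dist_eq fun x y => ?_
  rw [dist_eq_norm, dist_eq_norm, ← norm_rot hij t (x - y)]
  congr 1
  ext l
  simp [rot]
  fin_cases i <;> fin_cases j <;> simp at hij <;> fin_cases l <;> simp <;> ring

/-- The rotation `rot i j t` as an isometric equivalence. -/
def rotEquiv {i j : Fin 3} (hij : i ≠ j) (t : ℝ) : E3 ≃ᵢ E3 :=
  IsometryEquiv.mk' (rot i j t) (rot i j (-t)) (rot_rot_neg hij t) (isometry_rot hij t)

theorem integral_sphere_comp_rot {i j : Fin 3} (hij : i ≠ j) (t : ℝ) (f : E3 → ℝ) :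
    ∫ x in Metric.sphere (0 : E3) 1, f (rot i j t x) ∂(μH[2]) =
      ∫ x in Metric.sphere (0 : E3) 1, f x ∂(μH[2]) := by
  have h := ((rotEquiv hij t).measurePreserving_hausdorffMeasure 2).setIntegral_preimage_emb
    (rotEquiv hij t).toHomeomorph.measurableEmbedding f (Metric.sphere 0 1)
  have hs : rotEquiv hij t ⁻¹' Metric.sphere (0 : E3) 1 = Metric.sphere 0 1 := by
    ext x
    rw [Set.mem_preimage, mem_sphere_zero_iff_norm, mem_sphere_zero_iff_norm]
    exact iff_of_eq (congrArg (· = 1) (norm_rot hij t x))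
  rw [hs] at h
  exact h

theorem hasDerivAt_polyFun_rot {i j : Fin 3} (hij : i ≠ j) (P : MvPolynomial (Fin 3) ℝ)
    (x : E3) (t : ℝ) :
    HasDerivAt (fun s => polyFun P (rot i j s x))
      (polyFun (MvPolynomial.X i * MvPolynomial.pderiv j P -
        MvPolynomial.X j * MvPolynomial.pderiv i P) (rot i j t x)) t := by
  have h1 := ((((hasDerivAt_cos t).sub_const 1).smul_const
    (EuclideanSpace.single i (x i) + EuclideanSpace.single j (x j) : E3)).add
    ((hasDerivAt_sin t).smul_const
      (EuclideanSpace.single j (x i) - EuclideanSpace.single i (x j) : E3))).const_add x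
  have h2 := (hasFDerivAt_polyFun P (rot i j t x)).comp_hasDerivAt t h1
  refine h2.congr_deriv ?_
  fin_cases i <;> fin_cases j <;> simp at hij <;>
  · simp [polyFun, rot, Fin.sum_univ_three]
    ring

theorem integrable_polyFun_restrict_sphere (P : MvPolynomial (Fin 3) ℝ) :
    Integrable (polyFun P) ((μH[2] : Measure E3).restrict (Metric.sphere 0 1)) := by
  obtain ⟨C, hC⟩ := (isCompact_sphere (0 : E3) 1).exists_bound_of_continuousOn
    (continuous_polyFun P).continuousOn
  exact Integrable.of_bound (continuous_polyFun P).aestronglyMeasurable C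
    (ae_restrict_of_forall_mem Metric.isClosed_sphere.measurableSet hC)

/-- The infinitesimal rotation of a polynomial has vanishing integral over the sphere. -/
theorem integral_sphere_rotation_deriv {i j : Fin 3} (hij : i ≠ j)
    (P : MvPolynomial (Fin 3) ℝ) :
    ∫ x in Metric.sphere (0 : E3) 1, polyFun (MvPolynomial.X i * MvPolynomial.pderiv j P -
        MvPolynomial.X j * MvPolynomial.pderiv i P) x ∂(μH[2]) = 0 := by
  set Q := MvPolynomial.X i * MvPolynomial.pderiv j P -
        MvPolynomial.X j * MvPolynomial.pderiv i P with hQ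
  obtain ⟨C, hC⟩ := (isCompact_sphere (0 : E3) 1).exists_bound_of_continuousOn
    (continuous_polyFun Q).continuousOn
  have hcont (R : MvPolynomial (Fin 3) ℝ) (t : ℝ) : Continuous fun x => polyFun R (rot i j t x) :=
    (continuous_polyFun R).comp (isometry_rot hij t).continuous
  have hrot0 (x : E3) : rot i j 0 x = x := by simp [rot]
  have h := (hasDerivAt_integral_of_dominated_loc_of_deriv_le
    (μ := (μH[2] : Measure E3).restrict (Metric.sphere 0 1))
    (F := fun t x => polyFun P (rot i j t x)) (F' := fun t x => polyFun Q (rot i j t x))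
    (x₀ := 0) (s := Set.univ) (bound := fun _ => C) Filter.univ_mem
    (Filter.Eventually.of_forall fun t => (hcont P t).aestronglyMeasurable)
    (by simpa [hrot0] using integrable_polyFun_restrict_sphere P)
    (hcont Q 0).aestronglyMeasurable
    (ae_restrict_of_forall_mem Metric.isClosed_sphere.measurableSet fun x hx t _ =>
      hC _ (by simpa [norm_rot hij] using hx))
    (integrable_const C)
    (Filter.Eventually.of_forall fun x t _ => hasDerivAt_polyFun_rot hij P x t)).2
  simp only [integral_sphere_comp_rot hij] at h
  exact h.unique (hasDerivAt_const _ _)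

/-- for harmonic homogeneous polynomials `h` (degree `n ≥ 1`) and `g`
(degree `k ≥ 0`), the fields `∇h(x) × x` and `∇g(x)` are orthogonal in `L²(S²)³`:
`∫_{S²} (∇h(x) × x) · ∇g(x) dσ(x) = 0`. -/
theorem T_orthogonal_M (n k : ℕ) (hn : 1 ≤ n)
    (h g : MvPolynomial (Fin 3) ℝ)
    (hhomh : h.IsHomogeneous n) (hharmh : ∀ x, lap3 (polyFun h) x = 0)
    (hhomg : g.IsHomogeneous k) (hharmg : ∀ x, lap3 (polyFun g) x = 0) :
    ∫ x in Metric.sphere (0 : E3) 1,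
        ⟪cross3 (grad3 (polyFun h) x) x, grad3 (polyFun g) x⟫ ∂(μH[2]) = 0 := by
  have key (x : E3) : ⟪cross3 (grad3 (polyFun h) x) x, grad3 (polyFun g) x⟫ =
      polyFun (MvPolynomial.X 1 * MvPolynomial.pderiv 2 (g * MvPolynomial.pderiv 0 h) -
        MvPolynomial.X 2 * MvPolynomial.pderiv 1 (g * MvPolynomial.pderiv 0 h)) x +
      polyFun (MvPolynomial.X 2 * MvPolynomial.pderiv 0 (g * MvPolynomial.pderiv 1 h) -
        MvPolynomial.X 0 * MvPolynomial.pderiv 2 (g * MvPolynomial.pderiv 1 h)) x +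
      polyFun (MvPolynomial.X 0 * MvPolynomial.pderiv 1 (g * MvPolynomial.pderiv 2 h) -
        MvPolynomial.X 1 * MvPolynomial.pderiv 0 (g * MvPolynomial.pderiv 2 h)) x := by
    simp only [MvPolynomial.pderiv_mul, MvPolynomial.pderiv_pderiv_comm 1 0 h,
      MvPolynomial.pderiv_pderiv_comm 2 0 h, MvPolynomial.pderiv_pderiv_comm 2 1 h]
    simp [cross3, grad3, toE3, pd_polyFun, PiLp.inner_apply, Fin.sum_univ_three, polyFun]
    ring
  simp only [key]
  rw [integral_add (by
      exact (integrable_polyFun_restrict_sphere _).add (integrable_polyFun_restrict_sphere _))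
      (integrable_polyFun_restrict_sphere _),
    integral_add (integrable_polyFun_restrict_sphere _) (integrable_polyFun_restrict_sphere _),
    integral_sphere_rotation_deriv (by decide), integral_sphere_rotation_deriv (by decide),
    integral_sphere_rotation_deriv (by decide)]
  simp

end
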